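/- For n ≥ m ≥ 2 with n−m odd, the q-Kaplansky number K_q(n,m) is a symmetric and unimodal polynomial in q (of degree m(n−m)+m). -/

import Mathlib

open Polynomial Finset

/-- The Gaussian polynomial `[n m]_q`, as a polynomial in `ℤ[q]`
(it vanishes when `m > n`).  It is defined by the `q`-Pascal recursion
`[n m]_q = [n-1 m-1]_q + q^m [n-1 m]_q`. -/
noncomputable def gauss : ℕ → ℕ → Polynomial ℤ
  | _, 0 => 1
  | 0, _ + 1 => 0
  | n + 1, m + 1 => gauss n m + X ^ (m + 1) * gauss n (m + 1)

/-- The `q`-Kaplansky number `K_q(n,m) = ((1-q^(n+m))/(1-q^n))·[n m]_q`,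
defined as the polynomial `[n-1 m-1]_q + q^m·[n m]_q`. -/
noncomputable def kap (n : ℕ) : ℕ → Polynomial ℤ
  | 0 => 1
  | m + 1 => gauss (n - 1) m + X ^ (m + 1) * gauss n (m + 1)

/-- The number of ones of a (0,1)-sequence. -/
def numOnes {N : ℕ} (w : Fin N → Bool) : ℕ :=
  (Finset.univ.filter fun i => w i = true).card

/-- The inversion number of a (0,1)-sequence: the number of pairs `(i,j)`
with `i < j`, `w i = 1` and `w j = 0`. -/
def invW {N : ℕ} (w : Fin N → Bool) : ℕ :=
  ((Finset.univ : Finset (Fin N × Fin N)).filter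
    fun p => p.1 < p.2 ∧ w p.1 = true ∧ w p.2 = false).card

/-- The major index of a (0,1)-sequence: the sum of the (1-based) positions `i`
with `w_i > w_(i+1)`. -/
def majW {N : ℕ} (w : Fin N → Bool) : ℕ :=
  ∑ i : Fin N,
    if h : (i : ℕ) + 1 < N then
      (if w i = true ∧ w ⟨(i : ℕ) + 1, h⟩ = false then (i : ℕ) + 1 else 0)
    else 0


theorem gauss_zero_right (n : ℕ) : gauss n 0 = 1 := by cases n <;> simp [gauss]

theorem gauss_succ (n m : ℕ) :
    gauss (n+1) (m+1) = gauss n m + X ^ (m+1) * gauss n (m+1) := by rw [gauss]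

theorem gauss_rec {N n n' m : ℕ} (h : N = n+1) (h' : N = n'+1) :
    gauss N (m+1) = gauss n m + X ^ (m+1) * gauss n' (m+1) := by
  obtain rfl : n = n' := by omega
  rw [h, gauss_succ]

theorem gauss_of_lt : ∀ (n m : ℕ), n < m → gauss n m = 0
  | _, 0, h => by omega
  | 0, _ + 1, _ => by rw [gauss]
  | n + 1, m + 1, h => by
    rw [gauss_succ, gauss_of_lt n m (by omega), gauss_of_lt n (m+1) (by omega)]; simp

theorem gauss_self : ∀ n : ℕ, gauss n n = 1
  | 0 => gauss_zero_right 0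
  | n + 1 => by rw [gauss_succ, gauss_self n, gauss_of_lt n (n+1) (by omega)]; simp

/-- second Pascal -/
theorem gauss_succ' : ∀ (s a b : ℕ), a + b = s →
    gauss (a+b+1) (b+1) = gauss (a+b) (b+1) + X ^ a * gauss (a+b) b := by
  intro s
  induction s with
  | zero =>
    intro a b h
    obtain ⟨rfl, rfl⟩ : a = 0 ∧ b = 0 := by omega
    simp [gauss]
  | succ s ih =>
    intro a b h
    rcases a with _ | a
    · simp only [zero_add, pow_zero, one_mul]
      rw [gauss_self, gauss_self, gauss_of_lt b (b+1) (by omega)]; simp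
    rcases b with _ | b
    · have h1 := ih a 0 (by omega)
      have e1 : gauss (a+1+0+1) (0+1) = gauss (a+0+1) 0 + X^1 * gauss (a+0+1) (0+1) :=
        gauss_rec rfl rfl
      have e2 : gauss (a+1+0) (0+1) = gauss (a+0) 0 + X^1 * gauss (a+0) (0+1) :=
        gauss_succ _ _
      have e3 := h1.symm.trans e2
      simp only [gauss_zero_right, add_zero, zero_add] at *
      rw [e1, h1, mul_add, pow_succ X a]
      linear_combination -e3
    · have h1 := ih (a+1) b (by omega)
      have h2 := ih a (b+1) (by omega)
      have e1 : gauss (a+1+(b+1)+1) (b+1+1)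
          = gauss (a+1+b+1) (b+1) + X^(b+1+1) * gauss (a+(b+1)+1) (b+1+1) := by
        exact gauss_rec (by omega) (by omega)
      have e2 : gauss (a+1+(b+1)) (b+1+1)
          = gauss (a+1+b) (b+1) + X^(b+1+1) * gauss (a+(b+1)) (b+1+1) := by
        exact gauss_rec (by omega) (by omega)
      have e3 : gauss (a+1+(b+1)) (b+1)
          = gauss (a+1+b) b + X^(b+1) * gauss (a+(b+1)) (b+1) := by
        exact gauss_rec (by omega) (by omega)
      rw [e1, h1, h2, e2, e3]
      ring

theorem gauss_symm : ∀ (s a b : ℕ), a + b = s → (gauss (a+b) b).natDegree ≤ b * a ∧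
    reflect (b * a) (gauss (a+b) b) = gauss (a+b) b := by
  intro s
  induction s with
  | zero =>
    intro a b h
    obtain ⟨rfl, rfl⟩ : a = 0 ∧ b = 0 := by omega
    simp [gauss_zero_right]
  | succ s ih =>
    intro a b h
    rcases a with _ | a
    · simp [gauss_self]
    rcases b with _ | b
    · simp [gauss_zero_right]
    obtain ⟨d1, r1⟩ := ih (a+1) b (by omega)
    obtain ⟨d2, r2⟩ := ih a (b+1) (by omega)
    have e1 : gauss (a+1+(b+1)) (b+1) = gauss (a+1+b) b + X^(b+1) * gauss (a+(b+1)) (b+1) := by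
      exact gauss_rec (by omega) (by omega)
    have e2 : gauss (a+1+(b+1)) (b+1) = gauss (a+(b+1)) (b+1) + X^(a+1) * gauss (a+1+b) b := by
      have h2 := gauss_succ' _ (a+1) b rfl
      have h3 : a + (b+1) = a+1+b := by ring
      rw [h3, ← h2]; congr 1
    constructor
    · rw [e1]
      refine natDegree_add_le_of_degree_le (d1.trans (by nlinarith)) ?_
      refine natDegree_mul_le.trans ?_
      rw [natDegree_X_pow]
      nlinarith
    · conv_lhs => rw [e1]
      rw [e2, reflect_add]
      have q1 : (b+1)*(a+1) = b*(a+1) + (a+1) := by ring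
      have q2 : (b+1)*(a+1) = (b+1) + (b+1)*a := by ring
      have s1 := reflect_mul (gauss (a+1+b) b) 1 (G := a+1) d1 (by simp)
      have s2 := reflect_mul (X^(b+1)) (gauss (a+(b+1)) (b+1)) (F := b+1) (by simp) d2
      rw [mul_one, ← q1, r1, reflect_one] at s1
      rw [← q2, r2, reflect_monomial] at s2
      rw [s1, s2]
      simp
      ring

theorem kap_eq (a b : ℕ) : kap (a+b+2) (b+2)
    = gauss (a+1+(b+2)) (b+2) - X^(a+1) * gauss (a+1+b) b := by
  have h1 := gauss_succ' _ (a+1) b rfl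
  have h2 := gauss_succ (a+b+2) (b+1)
  have e : a+1+(b+2) = a+b+2+1 := by ring
  have e' : a+b+2 = a+1+b+1 := by ring
  rw [e, h2, e', h1, kap]
  simp only [Nat.add_sub_cancel]
  ring

theorem coeff_symm (a b i : ℕ) (hi : i ≤ (b+2)*a+(b+2)) :
    (kap (a+b+2) (b+2)).coeff i = (kap (a+b+2) (b+2)).coeff ((b+2)*a+(b+2) - i) := by
  have key : reflect ((b+2)*a+(b+2)) (kap (a+b+2) (b+2)) = kap (a+b+2) (b+2) := by
    rw [kap_eq, reflect_sub]
    obtain ⟨d1, r1⟩ := gauss_symm _ (a+1) (b+2) rfl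
    obtain ⟨d2, r2⟩ := gauss_symm _ (a+1) b rfl
    have q1 : (b+2)*a+(b+2) = (b+2)*(a+1) := by ring
    have q2 : (b+2)*a+(b+2) = (a+1)+(a+1) + b*(a+1) := by ring
    have s := reflect_mul (X^(a+1)) (gauss (a+1+b) b) (F := (a+1)+(a+1)) (by simp) d2
    rw [← q2, r2, reflect_monomial, revAt_le (by omega)] at s
    rw [s, q1, r1]
    simp
  conv_lhs => rw [← key]
  rw [coeff_reflect, revAt_le hi]

/-- generating function of tuples -/
noncomputable def tupGF (k m : ℕ) : Polynomial ℤ :=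
  ∑ e ∈ Finset.Nat.antidiagonalTuple k m, X ^ (∑ j : Fin k, (j : ℕ) * e j)

theorem tupGF_succ (k m : ℕ) :
    tupGF (k+1) m = ∑ p ∈ Finset.HasAntidiagonal.antidiagonal m, X ^ p.2 * tupGF k p.2 := by
  simp only [tupGF, Finset.mul_sum]
  rw [Finset.sum_sigma']
  refine Finset.sum_bij' (fun e _ => ⟨(e 0, ∑ j : Fin k, e j.succ), fun j => e j.succ⟩)
    (fun x _ => Fin.cons x.1.1 x.2) ?_ ?_ ?_ ?_ ?_
  · intro e he
    rw [Finset.Nat.mem_antidiagonalTuple, Fin.sum_univ_succ] at he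
    simp [Finset.Nat.mem_antidiagonalTuple, he]
  · rintro ⟨⟨x, y⟩, z⟩ h
    simp [Finset.Nat.mem_antidiagonalTuple] at h
    simp [Finset.Nat.mem_antidiagonalTuple, Fin.sum_univ_succ, h]
  · intro e he
    exact Fin.cons_self_tail e
  · rintro ⟨⟨x, y⟩, z⟩ h
    simp [Finset.Nat.mem_antidiagonalTuple] at h
    simp [h]
  · intro e he
    simp only [Fin.sum_univ_succ, ← pow_add]
    congr 1
    simp [add_mul, Finset.sum_add_distrib, add_comm]

theorem tupGF_eq (k m : ℕ) : tupGF (k+1) m = gauss (k+m) m := by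
  induction k generalizing m with
  | zero => simp [tupGF, gauss_self]
  | succ k ih =>
    rw [tupGF_succ]
    simp only [ih]
    induction m with
    | zero => simp [gauss_zero_right]
    | succ m ihm =>
      rw [Finset.Nat.sum_antidiagonal_succ, ihm]
      rw [add_comm]
      exact (gauss_rec (by omega) (by omega)).symm

theorem gauss_coeff (k m i : ℕ) : (gauss (k+m) m).coeff i =
    (((Finset.Nat.antidiagonalTuple (k+1) m).filter
      (fun e => ∑ j : Fin (k+1), (j : ℕ) * e j = i)).card : ℤ) := by
  rw [← tupGF_eq, tupGF, finsetSum_coeff, Finset.card_filter]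
  push_cast
  refine Finset.sum_congr rfl fun e _ => ?_
  rw [coeff_X_pow]
  simp [eq_comm]

/-- abstract sl2 argument -/
theorem sl2_inj {V : Type*} [AddCommGroup V] [Module ℚ V] (E F H : V →ₗ[ℚ] V)
    (hEF : ∀ v, E (F v) = F (E v) + H v) (W S : ℤ → Submodule ℚ V) (c : ℤ)
    (hFW : ∀ i, ∀ v ∈ W i, F v ∈ W (i-1))
    (hES : ∀ i, ∀ v ∈ S i, E v ∈ S (i+1)) (hFS : ∀ i, ∀ v ∈ S i, F v ∈ S (i-1))
    (hH : ∀ i, ∀ v ∈ W i, H v = ((2*i-c : ℤ) : ℚ) • v)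
    (hW : ∀ i < 0, W i = ⊥) (i : ℤ) (hi : 2 * i < c) (v : V) (hv : v ∈ W i)
    (hEv : E v ∈ S (i+1)) : v ∈ S i := by
  have hFk : ∀ k : ℕ, (F^k) v ∈ W (i-k) := by
    intro k
    induction k with
    | zero => simpa using hv
    | succ k ih =>
      rw [pow_succ', Module.End.mul_apply]
      have := hFW _ _ ih
      push_cast
      rwa [← sub_sub]
  have hFE : ∀ k : ℕ, (F^k) (E v) ∈ S (i+1-k) := by
    intro k
    induction k with
    | zero => simpa using hEv
    | succ k ih =>
      rw [pow_succ', Module.End.mul_apply]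
      have := hFS _ _ ih
      push_cast
      rwa [← sub_sub]
  have hcomm : ∀ k : ℕ, E ((F^(k+1)) v) = (F^(k+1)) (E v)
      + (((k+1) * (2*i-c-k) : ℤ) : ℚ) • (F^k) v := by
    intro k
    induction k with
    | zero =>
      simp only [zero_add, pow_one, pow_zero, Module.End.one_apply]
      rw [hEF, hH i v hv]; simp
    | succ k ih =>
      rw [pow_succ' F (k+1), Module.End.mul_apply, hEF, ih, hH _ _ (hFk (k+1)), map_add, map_smul,
        Module.End.mul_apply, ← Module.End.mul_apply F (F^k), ← pow_succ', add_assoc, ← add_smul]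
      congr 2
      push_cast
      ring
  have hstep : ∀ k : ℕ, (F^(k+1)) v ∈ S (i-(k+1)) → (F^k) v ∈ S (i-k) := by
    intro k hk
    have h1 := hES _ _ hk
    rw [hcomm] at h1
    have h2 := hFE (k+1)
    have e1 : i - ((k:ℤ)+1) + 1 = i - k := by ring
    have e2 : i + 1 - ((k+1 : ℕ) : ℤ) = i - k := by push_cast; ring
    rw [e1] at h1
    rw [e2] at h2
    have h3 := ((S (i-k)).add_mem_iff_right h2).1 h1
    refine ((S (i-k)).smul_mem_iff ?_).1 h3
    have : ((k:ℤ)+1) * (2*i-c-k) ≠ 0 := mul_ne_zero (by omega) (by omega)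
    exact_mod_cast this
  have hbig : ∀ k : ℕ, (F^k) v ∈ S (i-k) → v ∈ S i := by
    intro k
    induction k with
    | zero => intro h; simpa using h
    | succ k ih => intro h; exact ih (hstep k (by simpa using h))
  apply hbig (i.toNat+1)
  have := hFk (i.toNat+1)
  rw [hW _ (by omega), Submodule.mem_bot] at this
  rw [this]
  exact Submodule.zero_mem _

theorem deriv_mem {σ A : Type*} [AddCommGroup A] (w : σ → A) (s : A)
    (f : σ → MvPolynomial σ ℚ)
    (hf : ∀ j, MvPolynomial.IsWeightedHomogeneous w (f j) (w j + s)) (d : A)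
    (p : MvPolynomial σ ℚ) (hp : MvPolynomial.IsWeightedHomogeneous w p d) :
    MvPolynomial.IsWeightedHomogeneous w (MvPolynomial.mkDerivation ℚ f p) (d + s) := by
  induction hp using MvPolynomial.IsWeightedHomogeneous.induction_on with
  | zero => simpa using MvPolynomial.isWeightedHomogeneous_zero ℚ w (d+s)
  | add p q hp hq h1 h2 => rw [map_add]; exact h1.add h2
  | monomial e r he =>
    rw [MvPolynomial.mkDerivation_monomial]
    refine (MvPolynomial.weightedHomogeneousSubmodule ℚ w (d+s)).smul_mem r ?_
    refine (MvPolynomial.weightedHomogeneousSubmodule ℚ w (d+s)).sum_mem ?_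
    intro j hj
    rw [Finsupp.mem_support_iff] at hj
    have h1 : Finsupp.weight w (e - Finsupp.single j 1) = d - w j := by
      have h2 : e - Finsupp.single j 1 + Finsupp.single j 1 = e :=
        tsub_add_cancel_of_le (by
          rw [Finsupp.single_le_iff]; omega)
      have h3 := congrArg (Finsupp.weight w) h2
      rw [map_add, he, Finsupp.weight_single, one_smul] at h3
      exact eq_sub_of_add_eq h3
    have h4 := (MvPolynomial.isWeightedHomogeneous_monomial w (e - Finsupp.single j 1)
      ((e j : ℕ) : ℚ) h1).mul (hf j)
    have h5 : d - w j + (w j + s) = d + s := by abel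
    rw [h5] at h4
    exact h4

section rep
variable (M : ℕ)

noncomputable def vy (j : ℕ) : MvPolynomial (Fin (M+1)) ℚ :=
  if h : j < M+1 then MvPolynomial.X ⟨j, h⟩ else 0

def wt : Fin (M+1) → ℤ × ℤ := fun j => (1, (j : ℕ))

noncomputable def WW (m i : ℤ) : Submodule ℚ (MvPolynomial (Fin (M+1)) ℚ) :=
  MvPolynomial.weightedHomogeneousSubmodule ℚ (wt M) (m, i)

noncomputable def dE : Derivation ℚ (MvPolynomial (Fin (M+1)) ℚ) (MvPolynomial (Fin (M+1)) ℚ) :=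
  MvPolynomial.mkDerivation ℚ fun j => ((M : ℚ) - ((j : ℕ) : ℚ)) • vy M (j+1)

noncomputable def dF : Derivation ℚ (MvPolynomial (Fin (M+1)) ℚ) (MvPolynomial (Fin (M+1)) ℚ) :=
  MvPolynomial.mkDerivation ℚ fun j => (((j : ℕ) : ℚ)) • vy M (j-1)

noncomputable def dH : Derivation ℚ (MvPolynomial (Fin (M+1)) ℚ) (MvPolynomial (Fin (M+1)) ℚ) :=
  MvPolynomial.mkDerivation ℚ fun j => (2 * ((j : ℕ) : ℚ) - M) • MvPolynomial.X j

noncomputable def QQ : MvPolynomial (Fin (M+1)) ℚ :=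
  ∑ j ∈ Finset.range (M+1), ((-1)^j * (M.choose j : ℚ)) • (vy M j * vy M (M-j))

theorem vy_mem (j : ℕ) : vy M j ∈ WW M 1 j := by
  unfold vy
  split_ifs with h
  · exact MvPolynomial.isWeightedHomogeneous_X ℚ (wt M) ⟨j, h⟩
  · exact Submodule.zero_mem _

theorem vy_fin (j : Fin (M+1)) : vy M j = MvPolynomial.X j := by
  rw [vy, dif_pos j.2]

theorem dE_vy (j : ℕ) : dE M (vy M j) = ((M : ℚ) - (j : ℚ)) • vy M (j+1) := by
  by_cases h : j < M + 1
  · conv_lhs => rw [vy, dif_pos h]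
    rw [dE, MvPolynomial.mkDerivation_X]
  · have h' : ¬ (j + 1 < M + 1) := by omega
    simp [vy, h, h']

theorem dF_vy (j : ℕ) (h : j ≤ M) : dF M (vy M j) = (j : ℚ) • vy M (j-1) := by
  conv_lhs => rw [vy, dif_pos (by omega : j < M + 1)]
  rw [dF, MvPolynomial.mkDerivation_X]

theorem dE_mem (m i : ℤ) : ∀ p ∈ WW M m i, dE M p ∈ WW M m (i+1) := by
  intro p hp
  have := deriv_mem (wt M) (0, 1) (fun j => ((M : ℚ) - ((j : ℕ) : ℚ)) • vy M (j+1)) (fun j => by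
    refine Submodule.smul_mem (MvPolynomial.weightedHomogeneousSubmodule ℚ _ _) _ ?_
    have h : MvPolynomial.IsWeightedHomogeneous (wt M) (vy M (j+1)) (1, ((j+1 : ℕ) : ℤ)) :=
      vy_mem M (j+1)
    simpa [wt] using h) _ p hp
  have e : ((m, i) : ℤ × ℤ) + (0, 1) = (m, i+1) := by ext <;> simp
  rw [e] at this
  exact this

theorem dF_mem (m i : ℤ) : ∀ p ∈ WW M m i, dF M p ∈ WW M m (i-1) := by
  intro p hp
  have := deriv_mem (wt M) (0, -1) (fun j => (((j : ℕ) : ℚ)) • vy M (j-1)) (fun j => by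
    by_cases hj : (j : ℕ) = 0
    · simp only [hj]
      simpa using MvPolynomial.isWeightedHomogeneous_zero ℚ (wt M) _
    refine Submodule.smul_mem (MvPolynomial.weightedHomogeneousSubmodule ℚ _ _) _ ?_
    have h : MvPolynomial.IsWeightedHomogeneous (wt M) (vy M (j-1)) (1, ((j-1 : ℕ) : ℤ)) :=
      vy_mem M (j-1)
    rw [Nat.cast_sub (by omega)] at h
    simpa [wt, sub_eq_add_neg] using h) _ p hp
  have e : ((m, i) : ℤ × ℤ) + (0, -1) = (m, i-1) := by ext <;> simp [sub_eq_add_neg]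
  rw [e] at this
  exact this

theorem wt_weight (e : Fin (M+1) →₀ ℕ) :
    Finsupp.weight (wt M) e = (∑ j, (e j : ℤ), ∑ j : Fin (M+1), ((j : ℕ) : ℤ) * (e j : ℤ)) := by
  rw [Finsupp.weight_apply, Finsupp.sum_fintype _ _ (by simp)]
  ext
  · simp [wt, Prod.fst_sum]
  · simp [wt, Prod.snd_sum, mul_comm]

theorem dH_apply (m i : ℤ) : ∀ p ∈ WW M m i, dH M p = ((2*i-m*M : ℤ) : ℚ) • p := by
  intro p hp
  have hp' : MvPolynomial.IsWeightedHomogeneous (wt M) p (m, i) := hp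
  clear hp
  induction hp' using MvPolynomial.IsWeightedHomogeneous.induction_on with
  | zero => simp
  | add p q hp hq h1 h2 => rw [map_add, h1, h2, smul_add]
  | monomial e r he =>
    rw [wt_weight, Prod.mk.injEq] at he
    obtain ⟨h1, h2⟩ := he
    rw [dH, MvPolynomial.mkDerivation_monomial, Finsupp.sum_fintype _ _ (by simp)]
    have : ∀ j : Fin (M+1), (MvPolynomial.monomial (e - Finsupp.single j 1) ((e j : ℕ) : ℚ)) •
        ((2 * ((j : ℕ) : ℚ) - M) • (MvPolynomial.X j : MvPolynomial (Fin (M+1)) ℚ))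
        = ((e j : ℚ) * (2 * ((j : ℕ) : ℚ) - M)) • MvPolynomial.monomial e (1:ℚ) := by
      intro j
      by_cases hj : e j = 0
      · simp [hj]
      have h2 : e - Finsupp.single j 1 + Finsupp.single j 1 = e :=
        tsub_add_cancel_of_le (by
          rw [Finsupp.single_le_iff]; omega)
      rw [MvPolynomial.X, smul_eq_mul, MvPolynomial.smul_monomial, MvPolynomial.monomial_mul, h2,
        MvPolynomial.smul_monomial]
      simp
    rw [Finset.sum_congr rfl (fun j _ => this j), ← Finset.sum_smul, smul_smul,
      MvPolynomial.smul_monomial, MvPolynomial.smul_monomial]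
    congr 1
    rw [← h1, ← h2]
    push_cast
    simp only [smul_eq_mul, mul_one, mul_sub, Finset.sum_sub_distrib, Finset.sum_mul,
      Finset.mul_sum, sub_mul]
    congr 1
    · refine Finset.sum_congr rfl fun j _ => by ring
    · refine Finset.sum_congr rfl fun j _ => by ring

theorem comm_EF (p : MvPolynomial (Fin (M+1)) ℚ) :
    dE M (dF M p) = dF M (dE M p) + dH M p := by
  have h : ⁅dE M, dF M⁆ = dH M := by
    refine MvPolynomial.derivation_ext fun j => ?_
    rw [Derivation.commutator_apply, ← vy_fin, dF_vy M j (by omega), dE_vy, Derivation.map_smul, Derivation.map_smul,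
      dE_vy, vy_fin M j, dH, MvPolynomial.mkDerivation_X, ← vy_fin]
    have hj : (j : ℕ) ≤ M := by omega
    have e1 : ((j:ℕ) : ℚ) • (((M:ℚ) - (((j:ℕ)-1 : ℕ) : ℚ)) • vy M ((j:ℕ)-1+1))
        = (((j:ℕ):ℚ) * ((M:ℚ) - ((j:ℕ):ℚ) + 1)) • vy M j := by
      by_cases h0 : (j:ℕ) = 0
      · simp [h0]
      · rw [Nat.cast_sub (by omega), Nat.sub_add_cancel (by omega), smul_smul]
        congr 2; push_cast; ring
    have e2 : ((M:ℚ) - ((j:ℕ) : ℚ)) • dF M (vy M ((j:ℕ)+1))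
        = (((M:ℚ) - ((j:ℕ) : ℚ)) * (((j:ℕ):ℚ)+1)) • vy M j := by
      by_cases h0 : (j:ℕ) = M
      · simp [h0]
      · rw [dF_vy M _ (by omega), smul_smul]
        simp
    rw [e1, e2, ← sub_smul]
    congr 1; ring
  rw [← h, Derivation.commutator_apply]; abel

theorem choose_q (j : ℕ) (hj : j ≤ M) :
    (M.choose (j+1) : ℚ) * (j+1) = M.choose j * (M - j) := by
  have := Nat.choose_succ_right_eq M j
  rw [← Nat.cast_sub hj]
  exact_mod_cast this

theorem dE_Q : dE M (QQ M) = 0 := by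
  have h : ∀ j ∈ Finset.range (M+1),
      dE M (((-1)^j * (M.choose j : ℚ)) • (vy M j * vy M (M-j))) =
      ((-1)^j * (M.choose j : ℚ) * (M - j)) • (vy M (j+1) * vy M (M-j)) -
      (if j = 0 then 0 else ((-1)^(j-1) * (M.choose (j-1) : ℚ) * (M - (j-1 : ℕ))) •
        (vy M (j-1+1) * vy M (M-(j-1)))) := by
    intro j hj
    rw [Finset.mem_range] at hj
    rw [Derivation.map_smul, Derivation.leibniz, dE_vy, dE_vy, Nat.cast_sub (by omega)]
    rcases j with _ | j
    · simp [mul_comm]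
    · have e : M - (j+1) + 1 = M - j := by omega
      have c := choose_q M j (by omega)
      simp only [Nat.add_sub_cancel, e, Nat.add_eq_zero_iff, one_ne_zero, and_false, if_false,
        smul_eq_mul, mul_smul_comm, smul_add, smul_smul]
      rw [mul_assoc ((-1)^j) _ ((M:ℚ) - j), ← c, sub_eq_add_neg (_ • _), ← neg_smul, add_comm (_ • _)]
      congr 1
      · rw [mul_comm (vy M (M - (j+1)))]
      · congr 1
        push_cast; ring
  rw [QQ, map_sum, Finset.sum_congr rfl h, Finset.sum_sub_distrib, Finset.sum_range_succ,
    Finset.sum_range_succ']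
  simp

theorem dF_Q : dF M (QQ M) = 0 := by
  have h : ∀ j ∈ Finset.range (M+1),
      dF M (((-1)^j * (M.choose j : ℚ)) • (vy M j * vy M (M-j))) =
      ((-1)^j * (M.choose j : ℚ) * (M - j)) • (vy M j * vy M (M-j-1)) -
      (if j = 0 then 0 else ((-1)^(j-1) * (M.choose (j-1) : ℚ) * (M - (j-1 : ℕ))) •
        (vy M (j-1) * vy M (M-(j-1)-1))) := by
    intro j hj
    rw [Finset.mem_range] at hj
    rw [Derivation.map_smul, Derivation.leibniz, dF_vy _ _ (by omega), dF_vy _ _ (by omega),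
      Nat.cast_sub (by omega)]
    rcases j with _ | j
    · simp
    · have e : M - (j+1) = M - j - 1 := by omega
      have c := choose_q M j (by omega)
      simp only [Nat.add_sub_cancel, e, Nat.add_eq_zero_iff, one_ne_zero, and_false, if_false,
        smul_eq_mul, mul_smul_comm, smul_add, smul_smul]
      rw [mul_assoc ((-1)^j) _ ((M:ℚ) - j), ← c, sub_eq_add_neg (_ • _), ← neg_smul]
      congr 1
      rw [mul_comm (vy M (M - j - 1))]
      congr 1
      push_cast; ring
  rw [QQ, map_sum, Finset.sum_congr rfl h, Finset.sum_sub_distrib, Finset.sum_range_succ,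
    Finset.sum_range_succ']
  simp

theorem Q_mem : QQ M ∈ WW M 2 M := by
  refine Submodule.sum_mem _ fun j hj => Submodule.smul_mem _ _ ?_
  rw [Finset.mem_range] at hj
  have h := MvPolynomial.IsWeightedHomogeneous.mul (vy_mem M j) (vy_mem M (M-j))
  have e : ((1:ℤ), (j:ℤ)) + (1, ((M-j : ℕ):ℤ)) = (2, (M:ℤ)) := by
    rw [Nat.cast_sub (by omega)]; ext <;> simp
  rw [e] at h
  exact h

theorem Q_ne (hM : Even M) (h0 : M ≠ 0) : QQ M ≠ 0 := by
  intro h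
  have h1 := congrArg (MvPolynomial.eval (fun j : Fin (M+1) =>
    if (j:ℕ) = 0 ∨ (j:ℕ) = M then (1:ℚ) else 0)) h
  have hy : ∀ j, j ≤ M → MvPolynomial.eval (fun j : Fin (M+1) =>
    if (j:ℕ) = 0 ∨ (j:ℕ) = M then (1:ℚ) else 0) (vy M j) = if j = 0 ∨ j = M then (1:ℚ) else 0 := by
    intro j hj
    rw [vy, dif_pos (by omega)]; simp
  rw [QQ, map_sum, map_zero] at h1
  obtain ⟨k, rfl⟩ : ∃ k, M = k + 1 := ⟨M-1, by omega⟩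
  rw [Finset.sum_range_succ, Finset.sum_range_succ', Finset.sum_eq_zero] at h1
  · simp only [MvPolynomial.smul_eval, map_mul, Nat.sub_zero, Nat.sub_self, hM.neg_one_pow,
      hy 0 (Nat.zero_le _), hy (k+1) le_rfl] at h1
    norm_num at h1
  · intro j hj
    rw [Finset.mem_range] at hj
    rw [MvPolynomial.smul_eval, map_mul, hy _ (by omega)]
    rw [if_neg (by omega)]
    simp

theorem WW_bot (m i : ℤ) (hi : i < 0) : WW M m i = ⊥ := by
  rw [eq_bot_iff]
  intro p hp
  have hp' : MvPolynomial.IsWeightedHomogeneous (wt M) p (m, i) := hp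
  rw [Submodule.mem_bot]
  refine hp'.eq_zero_of_no_monomials fun e he => ?_
  rw [wt_weight, Prod.mk.injEq] at he
  have : 0 ≤ ∑ j : Fin (M+1), ((j : ℕ) : ℤ) * (e j : ℤ) := by positivity
  omega

noncomputable def eqvSet (m i : ℕ) : {e : Fin (M+1) →₀ ℕ | Finsupp.weight (wt M) e = ((m:ℤ), (i:ℤ))} ≃
    ((Finset.Nat.antidiagonalTuple (M+1) m).filter
      (fun e => ∑ j : Fin (M+1), (j : ℕ) * e j = i)) :=
  Finsupp.equivFunOnFinite.subtypeEquiv (by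
    intro e
    rw [Finset.mem_filter, Finset.Nat.mem_antidiagonalTuple, Set.mem_ofPred_eq, wt_weight,
      Prod.mk.injEq]
    simp only [Finsupp.equivFunOnFinite_apply]
    norm_cast)

noncomputable def WWbasis (m i : ℕ) : Module.Basis
    ((Finset.Nat.antidiagonalTuple (M+1) m).filter
      (fun e => ∑ j : Fin (M+1), (j : ℕ) * e j = i)) ℚ (WW M m i) :=
  ((MvPolynomial.basisRestrictSupport ℚ
    {e : Fin (M+1) →₀ ℕ | Finsupp.weight (wt M) e = ((m:ℤ), (i:ℤ))}).map
    (LinearEquiv.ofEq _ _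
      (MvPolynomial.weightedHomogeneousSubmodule_eq_finsupp_supported ℚ (wt M) _).symm)).reindex
    (eqvSet M m i)

theorem WW_finrank (m i : ℕ) : (Module.finrank ℚ (WW M m i) : ℤ) = (gauss (M+m) m).coeff i := by
  rw [Module.finrank_eq_card_basis (WWbasis M m i), gauss_coeff, Fintype.card_coe]

theorem WW_finite (m : ℕ) (i : ℤ) : Module.Finite ℚ (WW M m i) := by
  rcases lt_or_ge i 0 with h | h
  · rw [WW_bot M m i h]; infer_instance
  · lift i to ℕ using h
    exact Module.Finite.of_basis (WWbasis M m i)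

noncomputable def SS (m i : ℤ) : Submodule ℚ (MvPolynomial (Fin (M+1)) ℚ) :=
  (WW M (m-2) (i-M)).map (LinearMap.mulLeft ℚ (QQ M))

theorem SS_le (m i : ℤ) : SS M m i ≤ WW M m i := by
  rintro _ ⟨g, hg, rfl⟩
  have h := MvPolynomial.IsWeightedHomogeneous.mul (Q_mem M) hg
  have e : ((2:ℤ), (M:ℤ)) + (m-2, i-M) = (m, i) := by ext <;> simp
  rw [e] at h
  exact h

theorem SS_E (m i : ℤ) : ∀ p ∈ SS M m i, dE M p ∈ SS M m (i+1) := by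
  rintro _ ⟨g, hg, rfl⟩
  refine ⟨dE M g, ?_, ?_⟩
  · have := dE_mem M _ _ g hg
    rwa [show i - M + 1 = i + 1 - (M:ℤ) by ring] at this
  · simp [Derivation.leibniz, dE_Q]

theorem SS_F (m i : ℤ) : ∀ p ∈ SS M m i, dF M p ∈ SS M m (i-1) := by
  rintro _ ⟨g, hg, rfl⟩
  refine ⟨dF M g, ?_, ?_⟩
  · have := dF_mem M _ _ g hg
    rwa [show i - M - 1 = i - 1 - (M:ℤ) by ring] at this
  · simp [Derivation.leibniz, dF_Q]

theorem SS_finrank (hM : Even M) (h0 : M ≠ 0) (m i : ℤ) :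
    Module.finrank ℚ (SS M m i) = Module.finrank ℚ (WW M (m-2) (i-M)) := by
  refine (LinearEquiv.finrank_eq (Submodule.equivMapOfInjective _ ?_ _)).symm
  exact mul_right_injective₀ (Q_ne M hM h0)

theorem ww_rank_le (hM : Even M) (h0 : M ≠ 0) (m : ℕ) (i : ℤ) (hi : 2 * i < m * M) :
    (Module.finrank ℚ (WW M m i) : ℤ) - Module.finrank ℚ (WW M (m-2) (i-M)) ≤
    (Module.finrank ℚ (WW M m (i+1)) : ℤ) - Module.finrank ℚ (WW M (m-2) (i+1-M)) := by
  have := WW_finite M m i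
  have := WW_finite M m (i+1)
  rw [← SS_finrank M hM h0, ← SS_finrank M hM h0]
  let A := (SS M m i).comap (WW M m i).subtype
  let B := (SS M m (i+1)).comap (WW M m (i+1)).subtype
  have hA : Module.finrank ℚ A = Module.finrank ℚ (SS M m i) :=
    LinearEquiv.finrank_eq (Submodule.comapSubtypeEquivOfLe (SS_le M m i))
  have hB : Module.finrank ℚ B = Module.finrank ℚ (SS M m (i+1)) :=
    LinearEquiv.finrank_eq (Submodule.comapSubtypeEquivOfLe (SS_le M m (i+1)))
  let φ : WW M m i →ₗ[ℚ] WW M m (i+1) :=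
    ((dE M : MvPolynomial (Fin (M+1)) ℚ →ₗ[ℚ] MvPolynomial (Fin (M+1)) ℚ)).restrict
      (dE_mem M m i)
  let ψ : WW M m i →ₗ[ℚ] (WW M m (i+1) ⧸ B) := B.mkQ ∘ₗ φ
  have hker : LinearMap.ker ψ ≤ A := by
    intro v hv
    have hv' : φ v ∈ B := by simpa [ψ] using hv
    have hv2 : dE M v ∈ SS M m (i+1) := hv'
    exact sl2_inj (dE M : MvPolynomial (Fin (M+1)) ℚ →ₗ[ℚ] MvPolynomial (Fin (M+1)) ℚ)
      (dF M : MvPolynomial (Fin (M+1)) ℚ →ₗ[ℚ] MvPolynomial (Fin (M+1)) ℚ)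
      (dH M : MvPolynomial (Fin (M+1)) ℚ →ₗ[ℚ] MvPolynomial (Fin (M+1)) ℚ)
      (comm_EF M) (WW M m) (SS M m) (m*M) (dF_mem M m) (SS_E M m) (SS_F M m)
      (dH_apply M m) (WW_bot M m) i hi v v.2 hv2
  have h1 := LinearMap.finrank_range_add_finrank_ker ψ
  have h2 := Submodule.finrank_mono hker
  have h3 := Submodule.finrank_le (LinearMap.range ψ)
  have h4 := Submodule.finrank_quotient_add_finrank B
  omega

theorem coeff_shift (m : ℕ) (i : ℕ) :
    (Module.finrank ℚ (WW M m ((i:ℤ)-M)) : ℤ) = (X^M * gauss (M+m) m).coeff i := by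
  rw [coeff_X_pow_mul']
  split_ifs with h
  · rw [← WW_finrank, Nat.cast_sub h]
  · rw [WW_bot M m _ (by omega)]; simp

end rep

theorem kap_mono (a b i : ℕ) (ha : Odd a) (hi : 2 * i < (b+2)*(a+1)) :
    (kap (a+b+2) (b+2)).coeff i ≤ (kap (a+b+2) (b+2)).coeff (i+1) := by
  have h := ww_rank_le (a+1) (by simpa using ha.add_one) (by omega) (b+2) i (by exact_mod_cast hi)
  have e : ((b+2 : ℕ) : ℤ) - 2 = (b : ℤ) := by push_cast; ring
  have e2 : (i:ℤ) + 1 = ((i+1 : ℕ) : ℤ) := by push_cast; ring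
  rw [e, e2, WW_finrank, WW_finrank, coeff_shift, coeff_shift] at h
  rw [kap_eq, coeff_sub, coeff_sub]
  exact h

/-- For `n ≥ m ≥ 2` with `n - m` odd, the `q`-Kaplansky number
`K_q(n,m)` is symmetric and unimodal as a polynomial of degree `D = m(n-m)+m`:
its coefficients satisfy `a_i = a_(D-i)` for `0 ≤ i ≤ D`, and
`a_0 ≤ a_1 ≤ ⋯ ≤ a_(⌊D/2⌋) ≥ ⋯ ≥ a_(D-1) ≥ a_D`. -/
theorem kaplansky_symmetric_unimodal (n m : ℕ) (hm : 2 ≤ m) (hmn : m ≤ n)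
    (hodd : Odd (n - m)) :
    (∀ i ≤ m * (n - m) + m,
      (kap n m).coeff i = (kap n m).coeff (m * (n - m) + m - i)) ∧
    (∀ i < (m * (n - m) + m) / 2,
      (kap n m).coeff i ≤ (kap n m).coeff (i + 1)) ∧
    (∀ i, (m * (n - m) + m) / 2 ≤ i → i < m * (n - m) + m →
      (kap n m).coeff (i + 1) ≤ (kap n m).coeff i) := by
  obtain ⟨b, rfl⟩ : ∃ b, m = b + 2 := ⟨m-2, by omega⟩
  obtain ⟨a, rfl⟩ : ∃ a, n = a + b + 2 := ⟨n-(b+2), by omega⟩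
  have e : a + b + 2 - (b + 2) = a := by omega
  rw [e] at hodd ⊢
  have hD : (b+2)*(a+1) = (b+2)*a+(b+2) := by ring
  have hev : Even ((b+2)*a+(b+2)) := by
    rw [← hD]; exact Even.mul_left hodd.add_one _
  obtain ⟨r, hr⟩ := hev
  refine ⟨fun i hi => coeff_symm a b i hi, fun i hi => ?_, fun i h1 h2 => ?_⟩
  · exact kap_mono a b i hodd (by rw [hD]; omega)
  · rw [coeff_symm a b i (by omega), coeff_symm a b (i+1) (by omega)]
    have := kap_mono a b ((b+2)*a+(b+2) - (i+1)) hodd (by rw [hD]; omega)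
    rwa [show (b+2)*a+(b+2) - (i+1) + 1 = (b+2)*a+(b+2) - i by omega] at this
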